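/- Let G = (V, E) be an almost bipartite graph with special vertices b, t and bipartition H_1 ∪ H_2 of V_H, and let G' be its split graph. Then the minimum, over all partitions of V into S_b ∋ b and S_t ∋ t, of the number of uncut edges of G equals the minimum cardinality of a set of edges of G' whose removal leaves no path from a vertex of {b_1, t_2} to a vertex of {b_2, t_1}. -/

import Mathlib

/-- An edge is uncut (w.r.t. the partition `(S, Sᶜ)` of the vertices) if both
of its endpoints lie in the same part. -/
def UncutEdge {V : Type} (S : Set V) (e : Sym2 V) : Prop :=
  (∀ x ∈ e, x ∈ S) ∨ (∀ x ∈ e, x ∉ S)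

/-- The number of uncut edges of `G` w.r.t. the partition `(S, Sᶜ)`. -/
noncomputable def uncutCount {V : Type} (G : SimpleGraph V) (S : Set V) : ℕ :=
  Nat.card {e : Sym2 V // e ∈ G.edgeSet ∧ UncutEdge S e}

/-- A graph is almost bipartite with special vertices `b` and `t`:
removing `b` and `t` leaves a bipartite graph (all remaining edges are
incident to `b` or to `t`). -/
def AlmostBipartite {V : Type} (G : SimpleGraph V) (b t : V) : Prop :=
  b ≠ t ∧ ∃ C : Set V, ∀ ⦃u v : V⦄, G.Adj u v →
    u ≠ b → u ≠ t → v ≠ b → v ≠ t → (u ∈ C ↔ v ∉ C)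

/-- The four new vertices of the split graph. -/
inductive ExtraVert : Type
  | b1 | b2 | t1 | t2
deriving DecidableEq

open ExtraVert in
instance : Fintype ExtraVert :=
  ⟨{b1, b2, t1, t2}, by intro x; cases x <;> decide⟩

/-- The vertex set of the split graph `G'`: the vertices of `V_H = V \ {b, t}`
together with the four new vertices `b₁, b₂, t₁, t₂`. -/
def SplitVert (V : Type) (b t : V) : Type :=
  {v : V // v ≠ b ∧ v ≠ t} ⊕ ExtraVert

/-- The edges of the split graph: edges of `H` are kept; every edge `(b, v)`
with `v ∈ H₁` becomes `(b₁, v)`, every edge `(b, v)` with `v ∈ H₂` becomes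
`(v, b₂)`, every edge `(t, v)` with `v ∈ H₁` becomes `(v, t₁)`, and every edge
`(t, v)` with `v ∈ H₂` becomes `(t₂, v)`. -/
def splitRel {V : Type} (G : SimpleGraph V) (b t : V) (H1 H2 : Set V) :
    SplitVert V b t → SplitVert V b t → Prop
  | Sum.inl u, Sum.inl v => G.Adj u v
  | Sum.inr ExtraVert.b1, Sum.inl v => G.Adj b v ∧ (v : V) ∈ H1
  | Sum.inl v, Sum.inr ExtraVert.b2 => G.Adj b v ∧ (v : V) ∈ H2
  | Sum.inl v, Sum.inr ExtraVert.t1 => G.Adj t v ∧ (v : V) ∈ H1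
  | Sum.inr ExtraVert.t2, Sum.inl v => G.Adj t v ∧ (v : V) ∈ H2
  | _, _ => False

/-- The split graph `G'` of an almost bipartite graph `G`. -/
def splitGraph {V : Type} (G : SimpleGraph V) (b t : V) (H1 H2 : Set V) :
    SimpleGraph (SplitVert V b t) :=
  SimpleGraph.fromRel (splitRel G b t H1 H2)

/-- The sources of the split graph: `b₁` and `t₂`. -/
def splitSource {V : Type} {b t : V} (x : SplitVert V b t) : Prop :=
  x = Sum.inr ExtraVert.b1 ∨ x = Sum.inr ExtraVert.t2

/-- The sinks of the split graph: `b₂` and `t₁`. -/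
def splitSink {V : Type} {b t : V} (x : SplitVert V b t) : Prop :=
  x = Sum.inr ExtraVert.b2 ∨ x = Sum.inr ExtraVert.t1

/-- The identification of `b₁, b₂` with `b` and of `t₁, t₂` with `t`. -/
def projVert {V : Type} {b t : V} : SplitVert V b t → V
  | Sum.inl v => v
  | Sum.inr ExtraVert.b1 => b
  | Sum.inr ExtraVert.b2 => b
  | Sum.inr ExtraVert.t1 => t
  | Sum.inr ExtraVert.t2 => t

instance {V : Type} [Finite V] {b t : V} : Finite (SplitVert V b t) :=
  inferInstanceAs (Finite ({v : V // v ≠ b ∧ v ≠ t} ⊕ ExtraVert))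

/-- The part containing `H₂`, `b₁` and `t₁` in the bipartition of the split graph. -/
def splitPart {V : Type} {b t : V} (H2 : Set V) : SplitVert V b t → Prop
  | Sum.inl v => (v : V) ∈ H2
  | Sum.inr ExtraVert.b1 => True
  | Sum.inr ExtraVert.b2 => False
  | Sum.inr ExtraVert.t1 => True
  | Sum.inr ExtraVert.t2 => False

open Classical in
/-- The vertex of the split graph that replaces `u` in the edge `(u, v)` of `G`. -/
noncomputable def splitLift {V : Type} (b t : V) (H1 : Set V) (u v : V) : SplitVert V b t :=
  if hb : u = b then if v ∈ H1 then Sum.inr ExtraVert.b1 else Sum.inr ExtraVert.b2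
  else if ht : u = t then if v ∈ H1 then Sum.inr ExtraVert.t1 else Sum.inr ExtraVert.t2
  else Sum.inl ⟨u, hb, ht⟩

section

variable {V : Type} {G : SimpleGraph V} {b t : V} {H1 H2 : Set V}

lemma splitLift_b_of_mem {v : V} (hv : v ∈ H1) :
    splitLift b t H1 b v = Sum.inr ExtraVert.b1 :=
  (dif_pos rfl).trans (if_pos hv)

lemma splitLift_b_of_notMem {v : V} (hv : v ∉ H1) :
    splitLift b t H1 b v = Sum.inr ExtraVert.b2 :=
  (dif_pos rfl).trans (if_neg hv)

lemma splitLift_t_of_mem (hbt : b ≠ t) {v : V} (hv : v ∈ H1) :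
    splitLift b t H1 t v = Sum.inr ExtraVert.t1 :=
  (dif_neg hbt.symm).trans ((dif_pos rfl).trans (if_pos hv))

lemma splitLift_t_of_notMem (hbt : b ≠ t) {v : V} (hv : v ∉ H1) :
    splitLift b t H1 t v = Sum.inr ExtraVert.t2 :=
  (dif_neg hbt.symm).trans ((dif_pos rfl).trans (if_neg hv))

lemma splitLift_of_ne {u : V} (hu : u ≠ b ∧ u ≠ t) (v : V) :
    splitLift b t H1 u v = Sum.inl ⟨u, hu⟩ :=
  (dif_neg hu.1).trans (dif_neg hu.2)

lemma projVert_splitLift (hbt : b ≠ t) (u v : V) :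
    projVert (splitLift b t H1 u v) = u := by
  by_cases hu : u ≠ b ∧ u ≠ t
  · rw [splitLift_of_ne hu]; rfl
  obtain rfl | rfl : u = b ∨ u = t := by tauto
  · by_cases hv : v ∈ H1
    · rw [splitLift_b_of_mem hv]; rfl
    · rw [splitLift_b_of_notMem hv]; rfl
  · by_cases hv : v ∈ H1
    · rw [splitLift_t_of_mem hbt hv]; rfl
    · rw [splitLift_t_of_notMem hbt hv]; rfl

lemma splitGraph_adj_projVert {x y : SplitVert V b t}
    (h : (splitGraph G b t H1 H2).Adj x y) : G.Adj (projVert x) (projVert y) := by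
  rw [splitGraph, SimpleGraph.fromRel_adj] at h
  rcases x with x | (_ | _ | _ | _) <;> rcases y with y | (_ | _ | _ | _) <;>
    simp_all [splitRel, projVert, G.adj_comm]

lemma splitLift_projVert (hbt : b ≠ t) (hdisj : ∀ v : V, ¬ (v ∈ H1 ∧ v ∈ H2))
    {x y : SplitVert V b t} (h : (splitGraph G b t H1 H2).Adj x y) :
    splitLift b t H1 (projVert x) (projVert y) = x := by
  rw [splitGraph, SimpleGraph.fromRel_adj] at h
  have hd : ∀ v ∈ H2, v ∉ H1 := fun v h2 h1 => hdisj v ⟨h1, h2⟩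
  rcases x with ⟨x, hx⟩ | (_ | _ | _ | _)
  · exact splitLift_of_ne hx _
  all_goals rcases y with ⟨y, hy⟩ | (_ | _ | _ | _) <;>
    simp only [splitRel, or_false, false_or, and_false, or_self] at h
  · exact splitLift_b_of_mem h.2.2
  · exact splitLift_b_of_notMem (hd y h.2.2)
  · exact splitLift_t_of_mem hbt h.2.2
  · exact splitLift_t_of_notMem hbt (hd y h.2.2)

lemma splitGraph_adj_of_splitRel {x y : SplitVert V b t} (hne : x ≠ y)
    (h : splitRel G b t H1 H2 x y) : (splitGraph G b t H1 H2).Adj x y :=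
  ⟨hne, .inl h⟩

lemma splitGraph_adj_splitLift_of_ne (hbt : b ≠ t)
    (hcover : ∀ v : V, (v ≠ b ∧ v ≠ t) ↔ (v ∈ H1 ∨ v ∈ H2)) {u v : V} (h : G.Adj u v)
    (hv : v ≠ b ∧ v ≠ t) :
    (splitGraph G b t H1 H2).Adj (splitLift b t H1 u v) (splitLift b t H1 v u) := by
  have hv2 : v ∉ H1 → v ∈ H2 := ((hcover v).1 hv).resolve_left
  rw [splitLift_of_ne hv]
  by_cases hu : u ≠ b ∧ u ≠ t
  · rw [splitLift_of_ne hu]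
    exact splitGraph_adj_of_splitRel
      (fun huv => h.ne (congrArg Subtype.val (Sum.inl_injective huv))) h
  obtain rfl | rfl : u = b ∨ u = t := by tauto
  · by_cases hv1 : v ∈ H1
    · rw [splitLift_b_of_mem hv1]
      exact splitGraph_adj_of_splitRel Sum.inr_ne_inl ⟨h, hv1⟩
    · rw [splitLift_b_of_notMem hv1]
      exact .symm (splitGraph_adj_of_splitRel Sum.inl_ne_inr ⟨h, hv2 hv1⟩)
  · by_cases hv1 : v ∈ H1
    · rw [splitLift_t_of_mem hbt hv1]
      exact .symm (splitGraph_adj_of_splitRel Sum.inl_ne_inr ⟨h, hv1⟩)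
    · rw [splitLift_t_of_notMem hbt hv1]
      exact splitGraph_adj_of_splitRel Sum.inr_ne_inl ⟨h, hv2 hv1⟩

lemma splitGraph_adj_splitLift (hbt : b ≠ t) (hadjbt : ¬ G.Adj b t)
    (hcover : ∀ v : V, (v ≠ b ∧ v ≠ t) ↔ (v ∈ H1 ∨ v ∈ H2)) {u v : V} (h : G.Adj u v) :
    (splitGraph G b t H1 H2).Adj (splitLift b t H1 u v) (splitLift b t H1 v u) := by
  by_cases hv : v ≠ b ∧ v ≠ t
  · exact splitGraph_adj_splitLift_of_ne hbt hcover h hv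
  refine (splitGraph_adj_splitLift_of_ne hbt hcover h.symm ?_).symm
  obtain rfl | rfl : v = b ∨ v = t := by tauto
  · exact ⟨h.ne, fun hu => hadjbt (hu ▸ h.symm)⟩
  · exact ⟨fun hu => hadjbt (hu ▸ h), h.ne⟩

lemma splitPart_iff_not_of_adj (hcover : ∀ v : V, (v ≠ b ∧ v ≠ t) ↔ (v ∈ H1 ∨ v ∈ H2))
    (hdisj : ∀ v : V, ¬ (v ∈ H1 ∧ v ∈ H2))
    (hbip1 : ∀ u v : V, G.Adj u v → u ∈ H1 → v ∉ H1)
    (hbip2 : ∀ u v : V, G.Adj u v → u ∈ H2 → v ∉ H2)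
    {x y : SplitVert V b t} (h : (splitGraph G b t H1 H2).Adj x y) :
    splitPart H2 x ↔ ¬ splitPart H2 y := by
  rw [splitGraph, SimpleGraph.fromRel_adj] at h
  have hd : ∀ v ∈ H1, v ∉ H2 := fun v h1 h2 => hdisj v ⟨h1, h2⟩
  rcases x with ⟨x, hx⟩ | (_ | _ | _ | _) <;> rcases y with ⟨y, hy⟩ | (_ | _ | _ | _)
  · have hxy : G.Adj x y := h.2.elim id fun h' => G.adj_symm h'
    have h1 := (hcover x).1 hx
    have h2 := (hcover y).1 hy
    have h3 := hbip1 x y hxy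
    have h4 := hbip2 x y hxy
    change x ∈ H2 ↔ y ∉ H2
    tauto
  all_goals simp_all [splitRel, splitPart]

lemma uncutEdge_mk {S : Set V} {u v : V} : UncutEdge S s(u, v) ↔ (u ∈ S ↔ v ∈ S) := by
  simp only [UncutEdge, Sym2.mem_iff, forall_eq_or_imp, forall_eq]
  tauto

/-- The edges of the split graph that come from uncut edges of `G`. -/
def splitUncut (G : SimpleGraph V) (b t : V) (H1 H2 S : Set V) : Set (Sym2 (SplitVert V b t)) :=
  {e | e ∈ (splitGraph G b t H1 H2).edgeSet ∧ UncutEdge S (e.map projVert)}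

lemma card_splitUncut (hbt : b ≠ t) (hadjbt : ¬ G.Adj b t)
    (hcover : ∀ v : V, (v ≠ b ∧ v ≠ t) ↔ (v ∈ H1 ∨ v ∈ H2))
    (hdisj : ∀ v : V, ¬ (v ∈ H1 ∧ v ∈ H2)) (S : Set V) :
    Nat.card (splitUncut G b t H1 H2 S) = uncutCount G S := by
  have hbij : Set.BijOn (Sym2.map projVert) (splitUncut G b t H1 H2 S)
      {e | e ∈ G.edgeSet ∧ UncutEdge S e} := by
    refine ⟨?_, ?_, ?_⟩
    · rintro ⟨x, y⟩ ⟨he, hu⟩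
      exact ⟨splitGraph_adj_projVert he, hu⟩
    · rintro ⟨x, y⟩ ⟨he, -⟩ ⟨x', y'⟩ ⟨he', -⟩ heq
      have he : (splitGraph G b t H1 H2).Adj x y := he
      have he' : (splitGraph G b t H1 H2).Adj x' y' := he'
      have hx := splitLift_projVert hbt hdisj he
      have hy := splitLift_projVert hbt hdisj he.symm
      have hx' := splitLift_projVert hbt hdisj he'
      have hy' := splitLift_projVert hbt hdisj he'.symm
      change s(projVert x, projVert y) = s(projVert x', projVert y') at heq
      change s(x, y) = s(x', y')
      rcases Sym2.eq_iff.1 heq with ⟨h1, h2⟩ | ⟨h1, h2⟩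
      · rw [h1, h2] at hx hy
        rw [← hx, ← hy, hx', hy']
      · rw [h1, h2] at hx hy
        rw [← hx, ← hy, hx', hy', Sym2.eq_swap]
    · rintro ⟨u, v⟩ ⟨he, hu⟩
      have hmap : Sym2.map projVert s(splitLift b t H1 u v, splitLift b t H1 v u) = s(u, v) := by
        simp only [Sym2.map_mk, projVert_splitLift hbt]
      exact ⟨_, ⟨splitGraph_adj_splitLift hbt hadjbt hcover he, by rwa [hmap]⟩, hmap⟩
  exact Nat.card_congr hbij.equiv

lemma mk_mem_splitUncut_iff (hcover : ∀ v : V, (v ≠ b ∧ v ≠ t) ↔ (v ∈ H1 ∨ v ∈ H2))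
    (hdisj : ∀ v : V, ¬ (v ∈ H1 ∧ v ∈ H2))
    (hbip1 : ∀ u v : V, G.Adj u v → u ∈ H1 → v ∉ H1)
    (hbip2 : ∀ u v : V, G.Adj u v → u ∈ H2 → v ∉ H2)
    {S : Set V} {x y : SplitVert V b t} (h : (splitGraph G b t H1 H2).Adj x y) :
    s(x, y) ∈ splitUncut G b t H1 H2 S ↔
      ¬ ((splitPart H2 x ↔ projVert x ∈ S) ↔ (splitPart H2 y ↔ projVert y ∈ S)) := by
  have hp := splitPart_iff_not_of_adj hcover hdisj hbip1 hbip2 h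
  have hm : s(x, y) ∈ splitUncut G b t H1 H2 S ↔ (projVert x ∈ S ↔ projVert y ∈ S) :=
    (and_iff_right h).trans uncutEdge_mk
  rw [hm]
  tauto

lemma exists_mem_edges_splitUncut (hcover : ∀ v : V, (v ≠ b ∧ v ≠ t) ↔ (v ∈ H1 ∨ v ∈ H2))
    (hdisj : ∀ v : V, ¬ (v ∈ H1 ∧ v ∈ H2))
    (hbip1 : ∀ u v : V, G.Adj u v → u ∈ H1 → v ∉ H1)
    (hbip2 : ∀ u v : V, G.Adj u v → u ∈ H2 → v ∉ H2)
    {S : Set V} (hb : b ∈ S) (ht : t ∉ S) {x y : SplitVert V b t}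
    (w : (splitGraph G b t H1 H2).Walk x y) (hx : splitSource x) (hy : splitSink y) :
    ∃ e ∈ w.edges, e ∈ splitUncut G b t H1 H2 S := by
  obtain ⟨d, hd, h1, h2⟩ := w.exists_boundary_dart {z | splitPart H2 z ↔ projVert z ∈ S}
    (by
      rcases hx with rfl | rfl
      exacts [⟨fun _ => hb, fun _ => trivial⟩, ⟨False.elim, ht⟩])
    (by
      rcases hy with rfl | rfl
      exacts [fun h => h.2 hb, fun h => ht (h.1 trivial)])
  refine ⟨d.edge, List.mem_map_of_mem hd, ?_⟩
  exact (mk_mem_splitUncut_iff hcover hdisj hbip1 hbip2 d.adj).2 fun h => h2 (h.1 h1)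

lemma exists_splitUncut_subset (hbt : b ≠ t)
    (hcover : ∀ v : V, (v ≠ b ∧ v ≠ t) ↔ (v ∈ H1 ∨ v ∈ H2))
    (hdisj : ∀ v : V, ¬ (v ∈ H1 ∧ v ∈ H2))
    (hbip1 : ∀ u v : V, G.Adj u v → u ∈ H1 → v ∉ H1)
    (hbip2 : ∀ u v : V, G.Adj u v → u ∈ H2 → v ∉ H2)
    {F : Set (Sym2 (SplitVert V b t))}
    (hF : ∀ (x y : SplitVert V b t) (w : (splitGraph G b t H1 H2).Walk x y),
      splitSource x → splitSink y → ∃ e ∈ w.edges, e ∈ F) :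
    ∃ S : Set V, b ∈ S ∧ t ∉ S ∧ splitUncut G b t H1 H2 S ⊆ F := by
  let R : SplitVert V b t → Prop := fun x =>
    ∃ (s : _) (w : (splitGraph G b t H1 H2).Walk s x), splitSource s ∧ ∀ e ∈ w.edges, e ∉ F
  have hsource : ∀ x, splitSource x → R x := fun x hx => ⟨x, .nil, hx, by simp⟩
  have hsink : ∀ x, splitSink x → ¬ R x := by
    rintro x hx ⟨s, w, hs, hw⟩
    obtain ⟨e, he, heF⟩ := hF s x w hs hx
    exact hw e he heF
  have hstep : ∀ x y, (splitGraph G b t H1 H2).Adj x y → s(x, y) ∉ F → R x → R y := by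
    rintro x y h hxy ⟨s, w, hs, hw⟩
    refine ⟨s, w.concat h, hs, fun e he => ?_⟩
    rw [SimpleGraph.Walk.edges_concat, List.concat_eq_append, List.mem_append,
      List.mem_singleton] at he
    rcases he with he | rfl
    exacts [hw e he, hxy]
  have hb1 : R (Sum.inr ExtraVert.b1) := hsource _ (.inl rfl)
  have ht2 : R (Sum.inr ExtraVert.t2) := hsource _ (.inr rfl)
  have hb2 : ¬ R (Sum.inr ExtraVert.b2) := hsink _ (.inl rfl)
  have ht1 : ¬ R (Sum.inr ExtraVert.t1) := hsink _ (.inr rfl)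
  clear_value R
  have hproj : ∀ x y : SplitVert V b t, projVert x = projVert y →
      ((splitPart H2 x ↔ R x) ↔ (splitPart H2 y ↔ R y)) := by
    intro x y hxy
    rcases x with ⟨x, hxb, hxt⟩ | (_ | _ | _ | _) <;>
      rcases y with ⟨y, hyb, hyt⟩ | (_ | _ | _ | _) <;>
      simp only [projVert] at hxy <;>
      first
      | exact (hyb hxy.symm).elim
      | exact (hyt hxy.symm).elim
      | simp_all [splitPart]
  let S : Set V := {v | ∃ x : SplitVert V b t, projVert x = v ∧ (splitPart H2 x ↔ R x)}
  have hS : ∀ x : SplitVert V b t, projVert x ∈ S ↔ (splitPart H2 x ↔ R x) := fun x =>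
    ⟨fun ⟨y, hy, h⟩ => (hproj y x hy).1 h, fun h => ⟨x, rfl, h⟩⟩
  refine ⟨S, (hS (Sum.inr ExtraVert.b1)).2 (by simp [splitPart, hb1]), fun h => ?_, ?_⟩
  · have := (hS (Sum.inr ExtraVert.t1)).1 h
    simp [splitPart, ht1] at this
  · rintro ⟨x, y⟩ he
    have h : (splitGraph G b t H1 H2).Adj x y := he.1
    have hm := (mk_mem_splitUncut_iff hcover hdisj hbip1 hbip2 h).1 he
    rw [hS, hS] at hm
    by_contra hn
    have h1 := hstep x y h hn
    have h2 := hstep y x h.symm (by rwa [Sym2.eq_swap])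
    tauto

end

/-- Let `G` be an almost bipartite graph with special
vertices `b, t` and bipartition `H₁ ∪ H₂` of `V_H`, and let `G'` be its split
graph.  The minimum number of uncut edges of `G` over all partitions
`(S_b ∋ b, S_t ∋ t)` equals the minimum cardinality of a set of edges of `G'`
whose removal leaves no path from `{b₁, t₂}` to `{b₂, t₁}`. -/
theorem almostBipartite_minUncut_eq_min_edge_cut_of_splitGraph
    {V : Type} [Fintype V] [DecidableEq V] (G : SimpleGraph V) (b t : V)
    (hbt : b ≠ t) (hadjbt : ¬ G.Adj b t)
    (H1 H2 : Set V)
    (hcover : ∀ v : V, (v ≠ b ∧ v ≠ t) ↔ (v ∈ H1 ∨ v ∈ H2))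
    (hdisj : ∀ v : V, ¬ (v ∈ H1 ∧ v ∈ H2))
    (hbip1 : ∀ u v : V, G.Adj u v → u ∈ H1 → v ∉ H1)
    (hbip2 : ∀ u v : V, G.Adj u v → u ∈ H2 → v ∉ H2) :
    sInf {n : ℕ | ∃ S : Set V, b ∈ S ∧ t ∉ S ∧ n = uncutCount G S}
      = sInf {n : ℕ | ∃ F : Set (Sym2 (SplitVert V b t)),
          F ⊆ (splitGraph G b t H1 H2).edgeSet ∧ n = Nat.card F ∧
          ∀ (x y : SplitVert V b t) (w : (splitGraph G b t H1 H2).Walk x y),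
            splitSource x → splitSink y → ∃ e ∈ w.edges, e ∈ F} := by
  refine le_antisymm ?_ ?_
  · refine le_csInf ⟨Nat.card (splitUncut G b t H1 H2 {b}), splitUncut G b t H1 H2 {b}, ?_⟩ ?_
    · exact ⟨fun e he => he.1, rfl, fun _ _ w hx hy => exists_mem_edges_splitUncut hcover hdisj
        hbip1 hbip2 (Set.mem_singleton b) (by simpa using hbt.symm) w hx hy⟩
    · rintro _ ⟨F, -, rfl, hF⟩
      obtain ⟨S, hb, ht, hS⟩ := exists_splitUncut_subset hbt hcover hdisj hbip1 hbip2 hF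
      refine le_trans (Nat.sInf_le ⟨S, hb, ht, rfl⟩) ?_
      rw [← card_splitUncut hbt hadjbt hcover hdisj]
      exact Nat.card_mono F.toFinite hS
  · refine le_csInf ⟨uncutCount G {b}, {b}, rfl, by simpa using hbt.symm, rfl⟩ ?_
    rintro _ ⟨S, hb, ht, rfl⟩
    exact Nat.sInf_le ⟨splitUncut G b t H1 H2 S, fun e he => he.1,
      (card_splitUncut hbt hadjbt hcover hdisj S).symm,
      fun _ _ w hx hy => exists_mem_edges_splitUncut hcover hdisj hbip1 hbip2 hb ht w hx hy⟩
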